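/- Fix a prime g ≥ 3. For every ε > 0 there exists a constant C = C(g, ε) such that for all real X ≥ 2 and all real Z with X^{1/(2g)} ≤ Z ≤ X, the sum of S_g(d;Z) over squarefree integers d with X ≤ d < 2X is at most C · X^ε · ( Z² X^{1/2} + Z^{g+2} X^{-1/2} ). -/

import Mathlib

/-- `Sg g d Z` is the number of ordered pairs `(p, p')` of distinct primes with
`Z ≤ p, p' < 2Z` for which there exist nonzero integers `u, v` with
`gcd(v, p·p') = 1` and `4(p·p')^g = u² + d·v²`. -/
noncomputable def Sg (g d : ℕ) (Z : ℝ) : ℕ :=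
  Nat.card {pq : ℕ × ℕ // pq.1.Prime ∧ pq.2.Prime ∧ pq.1 ≠ pq.2 ∧
    Z ≤ pq.1 ∧ (pq.1 : ℝ) < 2 * Z ∧ Z ≤ pq.2 ∧ (pq.2 : ℝ) < 2 * Z ∧
    ∃ u v : ℤ, u ≠ 0 ∧ v ≠ 0 ∧ Int.gcd v ((pq.1 : ℤ) * pq.2) = 1 ∧
      4 * ((pq.1 : ℤ) * pq.2) ^ g = u ^ 2 + (d : ℤ) * v ^ 2}

/-- The divisor bound: the number of divisors of `n` is `O(n ^ δ)` for every `δ > 0`. -/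
theorem Nat.exists_card_divisors_le_rpow {δ : ℝ} (hδ : 0 < δ) :
    ∃ C : ℝ, 1 ≤ C ∧ ∀ n : ℕ, n ≠ 0 → (n.divisors.card : ℝ) ≤ C * (n : ℝ) ^ δ := by
  have hl2 : 0 < Real.log 2 := Real.log_pos one_lt_two
  set K : ℝ := 1 + 1 / (δ * Real.log 2) with hK
  have hK1 : 1 ≤ K := by
    have : 0 < 1 / (δ * Real.log 2) := by positivity
    linarith
  set B : ℕ := ⌈(2 : ℝ) ^ (1 / δ)⌉₊ with hB
  have key : ∀ p a : ℕ, 2 ≤ p →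
      ((a : ℝ) + 1) ≤ (if p < B then K else 1) * ((p : ℝ) ^ a) ^ δ := by
    intro p a hp
    have hp2 : (2 : ℝ) ≤ p := by exact_mod_cast hp
    split_ifs with h
    · have h1 : (2 : ℝ) ^ (δ * a) ≤ ((p : ℝ) ^ a) ^ δ := by
        rw [← Real.rpow_natCast (p : ℝ) a, ← Real.rpow_mul (by positivity), mul_comm δ]
        exact Real.rpow_le_rpow (by norm_num) hp2 (by positivity)
      have h2 : Real.log 2 * (δ * a) + 1 ≤ (2 : ℝ) ^ (δ * a) := by
        rw [Real.rpow_def_of_pos two_pos]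
        exact Real.add_one_le_exp _
      have h3 : (a : ℝ) + 1 ≤ K * (Real.log 2 * (δ * a) + 1) := by
        have : K * (Real.log 2 * (δ * a) + 1)
            = (a : ℝ) + 1 + (Real.log 2 * (δ * a) + 1 / (δ * Real.log 2)) := by
          rw [hK]; field_simp; ring
        rw [this]
        have : 0 ≤ Real.log 2 * (δ * a) + 1 / (δ * Real.log 2) := by positivity
        linarith
      exact h3.trans (mul_le_mul_of_nonneg_left (h2.trans h1) (by linarith))
    · have h1 : (2 : ℝ) ^ (1 / δ) ≤ p := (Nat.le_ceil _).trans (by exact_mod_cast not_lt.mp h)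
      have h2 : (2 : ℝ) ≤ (p : ℝ) ^ δ := by
        calc (2 : ℝ) = ((2 : ℝ) ^ (1 / δ)) ^ δ := by
              rw [← Real.rpow_mul (by norm_num), one_div_mul_cancel hδ.ne', Real.rpow_one]
          _ ≤ _ := Real.rpow_le_rpow (by positivity) h1 hδ.le
      have h3 : ((p : ℝ) ^ a) ^ δ = ((p : ℝ) ^ δ) ^ a := by
        rw [← Real.rpow_natCast, ← Real.rpow_natCast, ← Real.rpow_mul (by positivity),
          ← Real.rpow_mul (by positivity), mul_comm]
      rw [one_mul, h3]
      calc (a : ℝ) + 1 ≤ 2 ^ a := by exact_mod_cast Nat.lt_two_pow_self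
        _ ≤ _ := pow_le_pow_left₀ (by norm_num) h2 a
  refine ⟨K ^ B, one_le_pow₀ hK1, fun n hn => ?_⟩
  rw [Nat.card_divisors hn]
  push_cast
  calc ∏ p ∈ n.primeFactors, ((n.factorization p : ℝ) + 1)
      ≤ ∏ p ∈ n.primeFactors,
          (if p < B then K else 1) * ((p : ℝ) ^ n.factorization p) ^ δ :=
        Finset.prod_le_prod (fun _ _ => by positivity)
          fun p hp => key p _ (Nat.prime_of_mem_primeFactors hp).two_le
    _ = (∏ p ∈ n.primeFactors, if p < B then K else 1) * (n : ℝ) ^ δ := by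
        rw [Finset.prod_mul_distrib, Real.finsetProd_rpow _ _ (fun _ _ => by positivity)]
        congr 2
        exact_mod_cast Nat.prod_factorization_pow_eq_self hn
    _ ≤ K ^ B * (n : ℝ) ^ δ := by
        refine mul_le_mul_of_nonneg_right ?_ (by positivity)
        rw [← Finset.prod_filter, Finset.prod_const]
        refine pow_le_pow_right₀ hK1 ?_
        calc _ ≤ (Finset.range B).card := Finset.card_le_card fun p hp => by
              simpa using (Finset.mem_filter.mp hp).2
          _ = B := Finset.card_range B

/-- Integers in an interval of length `L` lying in a single class after multiplication by `c`
modulo `M` number at most `c * L / M + 1`. -/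
theorem Finset.card_le_of_dvd_mul_sub {S : Finset ℤ} {c M : ℕ} {L : ℝ} (hc : 0 < c) (hM : 0 < M)
    (hL : 0 ≤ L) (hdist : ∀ x ∈ S, ∀ y ∈ S, (x : ℝ) - y ≤ L)
    (hdvd : ∀ x ∈ S, ∀ y ∈ S, (M : ℤ) ∣ c * (x - y)) :
    (S.card : ℝ) ≤ c * L / M + 1 := by
  rcases S.eq_empty_or_nonempty with rfl | hS
  · simp only [Finset.card_empty, Nat.cast_zero]; positivity
  have hM' : (0 : ℝ) < M := by exact_mod_cast hM
  set m := S.min' hS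
  have hm : m ∈ S := S.min'_mem hS
  have hcard : S.card ≤ (Finset.range (⌊c * L / M⌋₊ + 1)).card := by
    refine Finset.card_le_card_of_injOn (fun x => (c * (x - m) / M).toNat) ?_ ?_
    · intro x hx
      simp only [Finset.coe_range, Set.mem_Iio, Nat.lt_succ_iff]
      obtain ⟨k, hk⟩ := hdvd x hx m hm
      have hM0 : (M : ℤ) ≠ 0 := by exact_mod_cast hM.ne'
      rw [hk, Int.mul_ediv_cancel_left _ hM0]
      have hk0 : 0 ≤ k := by
        have h1 : (0 : ℤ) ≤ M * k := by
          rw [← hk]; exact mul_nonneg (by positivity) (sub_nonneg.mpr (S.min'_le x hx))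
        exact nonneg_of_mul_nonneg_right h1 (by exact_mod_cast hM)
      refine Nat.le_floor ?_
      have hkk : ((k.toNat : ℕ) : ℝ) = (k : ℝ) := by exact_mod_cast Int.toNat_of_nonneg hk0
      rw [hkk, le_div_iff₀ hM']
      have h2 : (c : ℝ) * ((x : ℝ) - m) = M * k := by exact_mod_cast hk
      have h3 := mul_le_mul_of_nonneg_left (hdist x hx m hm) (Nat.cast_nonneg (α := ℝ) c)
      linarith
    · intro x hx y hy hxy
      obtain ⟨k, hk⟩ := hdvd x hx m hm
      obtain ⟨l, hl⟩ := hdvd y hy m hm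
      have hM0 : (M : ℤ) ≠ 0 := by exact_mod_cast hM.ne'
      have hc0 : (0 : ℤ) < c := by exact_mod_cast hc
      have hMp : (0 : ℤ) < M := by exact_mod_cast hM
      have hx0 := mul_nonneg hc0.le (sub_nonneg.mpr (S.min'_le x hx))
      have hy0 := mul_nonneg hc0.le (sub_nonneg.mpr (S.min'_le y hy))
      simp only at hxy
      change 0 ≤ (c : ℤ) * (x - m) at hx0
      change 0 ≤ (c : ℤ) * (y - m) at hy0
      rw [hk, hl, Int.mul_ediv_cancel_left _ hM0, Int.mul_ediv_cancel_left _ hM0] at hxy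
      rw [hk] at hx0
      rw [hl] at hy0
      have hk0 := nonneg_of_mul_nonneg_right hx0 hMp
      have hl0 := nonneg_of_mul_nonneg_right hy0 hMp
      have : k = l := by omega
      subst this
      have := mul_left_cancel₀ hc0.ne' (hk.trans hl.symm)
      linarith
  rw [Finset.card_range] at hcard
  calc (S.card : ℝ) ≤ (⌊c * L / M⌋₊ : ℝ) + 1 := by exact_mod_cast hcard
    _ ≤ _ := by gcongr; exact Nat.floor_le (by positivity)

/-- Two solutions `x, y` of `u ^ 2 ≡ 4 * N` modulo `v ^ 2` with the same value of
`gcd (v ^ 2, u - w)`, for a third solution `w`, satisfy `4 * x ≡ 4 * y` modulo `v ^ 2`. -/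
theorem Int.sq_dvd_four_mul_sub {N v w x y : ℤ} (hv : v ≠ 0) (hcop : IsCoprime v N)
    (hw : v ^ 2 ∣ w ^ 2 - 4 * N) (hx : v ^ 2 ∣ x ^ 2 - 4 * N) (hy : v ^ 2 ∣ y ^ 2 - 4 * N)
    (hxy : Int.gcd (v ^ 2) (x - w) = Int.gcd (v ^ 2) (y - w)) :
    v ^ 2 ∣ 4 * (x - y) := by
  have hv2 : v ^ 2 ≠ 0 := pow_ne_zero 2 hv
  set h : ℤ := (Int.gcd (v ^ 2) (x - w) : ℤ) with hh
  have h0 : h ≠ 0 := by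
    rw [hh]; exact_mod_cast (Int.gcd_pos_of_ne_zero_left _ hv2).ne'
  obtain ⟨k, hk⟩ : h ∣ v ^ 2 := Int.gcd_dvd_left _ _
  have hadd : ∀ z : ℤ, v ^ 2 ∣ z ^ 2 - 4 * N → h = (Int.gcd (v ^ 2) (z - w) : ℤ) → k ∣ z + w := by
    intro z hz hhz
    obtain ⟨t, ht⟩ : h ∣ z - w := hhz ▸ Int.gcd_dvd_right _ _
    have hcop' : IsCoprime k t := by
      have h1 : Int.gcd (h * k) (h * t) = h.natAbs := by
        rw [← hk, ← ht, hhz, Int.natAbs_natCast]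
      rw [Int.gcd_mul_left] at h1
      rw [Int.isCoprime_iff_gcd_eq_one]
      exact Nat.eq_of_mul_eq_mul_left (Int.natAbs_pos.mpr h0) (by simpa using h1)
    have h2 : h * k ∣ h * (t * (z + w)) := by
      rw [← hk, ← mul_assoc, ← ht]
      have h3 : (z - w) * (z + w) = (z ^ 2 - 4 * N) - (w ^ 2 - 4 * N) := by ring
      exact h3 ▸ dvd_sub hz hw
    exact hcop'.dvd_of_dvd_mul_left ((mul_dvd_mul_iff_left h0).mp h2)
  have hkx := hadd x hx hh
  have hky := hadd y hy (by rw [hh, hxy])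
  have hhx : h ∣ x - w := Int.gcd_dvd_right _ _
  have hhy : h ∣ y - w := by rw [hh, hxy]; exact Int.gcd_dvd_right _ _
  have hkxy : k ∣ x - y := by have := dvd_sub hkx hky; rwa [add_sub_add_right_eq_sub] at this
  have hhxy : h ∣ x - y := by have := dvd_sub hhx hhy; rwa [sub_sub_sub_cancel_right] at this
  set e : ℤ := (Int.gcd h k : ℤ) with he
  have heh : e ∣ h := Int.gcd_dvd_left _ _
  have hek : e ∣ k := Int.gcd_dvd_right _ _
  have hev2 : e ^ 2 ∣ v ^ 2 := by rw [hk, sq]; exact mul_dvd_mul heh hek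
  have hev : e ∣ v := (Int.pow_dvd_pow_iff two_ne_zero).mp hev2
  have he2w : e ∣ 2 * w := by
    have h1 : 2 * w = (x + w) - (x - w) := by ring
    exact h1 ▸ dvd_sub (hek.trans hkx) (heh.trans hhx)
  have he16 : e ^ 2 ∣ 4 ^ 2 := by
    have h1 : e ^ 2 ∣ (2 * w) ^ 2 := pow_dvd_pow_of_dvd he2w 2
    have h2 : e ^ 2 ∣ 4 * (w ^ 2 - 4 * N) := (hev2.trans hw).mul_left 4
    have h3 : N * 4 ^ 2 = (2 * w) ^ 2 - 4 * (w ^ 2 - 4 * N) := by ring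
    exact ((hcop.of_isCoprime_of_dvd_left hev).pow_left).dvd_of_dvd_mul_left (h3 ▸ dvd_sub h1 h2)
  have he4 : e ∣ 4 := (Int.pow_dvd_pow_iff two_ne_zero).mp he16
  obtain ⟨l, hl⟩ := Int.coe_lcm_dvd hhxy hkxy
  obtain ⟨f, hf⟩ := he4
  have hgl : v ^ 2 ∣ e * (Int.lcm h k : ℤ) := by
    have h1 : (Int.gcd h k * Int.lcm h k : ℤ) = ((h * k).natAbs : ℤ) := by
      rw [Int.natAbs_mul]; exact_mod_cast Int.gcd_mul_lcm h k
    rw [he, h1, hk]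
    exact Int.dvd_natAbs.mpr dvd_rfl
  have : 4 * (x - y) = (e * (Int.lcm h k : ℤ)) * (f * l) := by rw [hf, hl]; ring
  rw [this]
  exact hgl.mul_right _

/-- For coprime `v` and `N`, the number of integers `d` in `[X, 2X)` such that
`4 * N = u ^ 2 + d * v ^ 2` is solvable in `u` is at most `τ(v ^ 2) * (4 * √X / v + 1)`. -/
theorem Finset.card_le_of_four_mul_eq_sq_add_mul_sq {N : ℤ} {v : ℕ} {X : ℝ} {D : Finset ℕ}
    (hv : 0 < v) (hX : 0 ≤ X) (hcop : IsCoprime (v : ℤ) N)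
    (hD : ∀ d ∈ D, X ≤ (d : ℝ) ∧ (d : ℝ) < 2 * X)
    (hsol : ∀ d ∈ D, ∃ u : ℤ, 4 * N = u ^ 2 + d * (v : ℤ) ^ 2) :
    (D.card : ℝ) ≤ ((v ^ 2).divisors.card : ℝ) * (4 * √X / v + 1) := by
  have hsol' : ∀ d ∈ D, ∃ u : ℤ, 0 ≤ u ∧ 4 * N = u ^ 2 + d * (v : ℤ) ^ 2 := fun d hd => by
    obtain ⟨u, hu⟩ := hsol d hd
    exact ⟨|u|, abs_nonneg u, by rwa [sq_abs]⟩
  choose! u hu0 hu using hsol'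
  have hvz : (v : ℤ) ≠ 0 := by exact_mod_cast hv.ne'
  have hvr : (0 : ℝ) < v := by exact_mod_cast hv
  have hinj : Set.InjOn u D := by
    intro a ha b hb hab
    have h1 := hu a ha
    have h2 := hu b hb
    rw [← hab] at h2
    have h3 : (a : ℤ) * (v : ℤ) ^ 2 = b * (v : ℤ) ^ 2 := by linarith
    exact_mod_cast mul_right_cancel₀ (pow_ne_zero 2 hvz) h3
  rw [← Finset.card_image_of_injOn hinj]
  set S := D.image u with hS
  have hroot : ∀ x ∈ S, (v : ℤ) ^ 2 ∣ x ^ 2 - 4 * N := by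
    intro x hx
    obtain ⟨d, hd, rfl⟩ := Finset.mem_image.mp hx
    exact ⟨-d, by rw [hu d hd]; ring⟩
  have hdist : ∀ x ∈ S, ∀ y ∈ S, (x : ℝ) - y ≤ √X * v := by
    intro x hx y hy
    obtain ⟨a, ha, rfl⟩ := Finset.mem_image.mp hx
    obtain ⟨b, hb, rfl⟩ := Finset.mem_image.mp hy
    have h1 : 4 * (N : ℝ) = (u a : ℝ) ^ 2 + a * (v : ℝ) ^ 2 := by exact_mod_cast hu a ha
    have h2 : 4 * (N : ℝ) = (u b : ℝ) ^ 2 + b * (v : ℝ) ^ 2 := by exact_mod_cast hu b hb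
    have hb0 : (0 : ℝ) ≤ u b := by exact_mod_cast hu0 b hb
    rcases le_total (u a : ℝ) (u b) with h | h
    · have : 0 ≤ √X * v := by positivity
      linarith
    · refine le_of_sq_le_sq ?_ (by positivity)
      rw [mul_pow, Real.sq_sqrt hX]
      have h3 : ((b : ℝ) - a) * (v : ℝ) ^ 2 ≤ X * (v : ℝ) ^ 2 := by
        refine mul_le_mul_of_nonneg_right ?_ (by positivity)
        linarith [(hD b hb).2, (hD a ha).1]
      nlinarith [mul_nonneg hb0 (sub_nonneg.mpr h)]
  rcases S.eq_empty_or_nonempty with h | ⟨w, hw⟩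
  · rw [h, Finset.card_empty, Nat.cast_zero]; positivity
  have hmaps : ∀ x ∈ S, Int.gcd ((v : ℤ) ^ 2) (x - w) ∈ (v ^ 2).divisors := by
    intro x _
    refine Nat.mem_divisors.mpr ⟨?_, (pow_pos hv 2).ne'⟩
    have := Int.gcd_dvd_left ((v : ℤ) ^ 2) (x - w)
    exact_mod_cast this
  rw [Finset.card_eq_sum_card_fiberwise hmaps]
  push_cast
  rw [← nsmul_eq_mul]
  refine Finset.sum_le_card_nsmul _ _ _ fun h _ => ?_
  have := Finset.card_le_of_dvd_mul_sub
    (S := S.filter fun x => Int.gcd ((v : ℤ) ^ 2) (x - w) = h) (c := 4) (M := v ^ 2)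
    (L := √X * v) (by norm_num) (pow_pos hv 2) (by positivity)
    (fun x hx y hy => hdist x (Finset.mem_filter.mp hx).1 y (Finset.mem_filter.mp hy).1)
    (fun x hx y hy => by
      rw [Finset.mem_filter] at hx hy
      exact_mod_cast Int.sq_dvd_four_mul_sub hvz hcop (hroot w hw) (hroot x hx.1) (hroot y hy.1)
        (hx.2.trans hy.2.symm))
  refine this.trans (le_of_eq ?_)
  push_cast
  field_simp

/-- The sum of `τ(v ^ 2) * (a / v + 1)` over `1 ≤ v ≤ W` is `O(W ^ δ * (a + W))`. -/
theorem exists_sum_card_divisors_sq_le {δ : ℝ} (hδ : 0 < δ) :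
    ∃ C : ℝ, 0 < C ∧ ∀ a W : ℝ, 0 ≤ a → 0 ≤ W →
      ∑ v ∈ Finset.Icc 1 ⌊W⌋₊, ((v ^ 2).divisors.card : ℝ) * (a / v + 1) ≤
        C * W ^ δ * (a + W) := by
  obtain ⟨C, hC1, hC⟩ := Nat.exists_card_divisors_le_rpow (δ := δ / 4) (by positivity)
  have hC0 : 0 < C := by linarith
  refine ⟨C * (1 + 2 / δ), by positivity, fun a W ha hW => ?_⟩
  rcases lt_or_ge W 1 with h1 | h1
  · rw [Nat.floor_eq_zero.mpr h1, Finset.Icc_eq_empty (by norm_num), Finset.sum_empty]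
    positivity
  have hdiv : ∀ v ∈ Finset.Icc 1 ⌊W⌋₊,
      ((v ^ 2).divisors.card : ℝ) * (a / v + 1) ≤ C * W ^ (δ / 2) * (a * (v : ℝ)⁻¹ + 1) := by
    intro v hv
    rw [Finset.mem_Icc] at hv
    rw [div_eq_mul_inv]
    refine mul_le_mul_of_nonneg_right ?_ (by positivity)
    refine (hC _ (pow_pos hv.1 2).ne').trans ?_
    refine mul_le_mul_of_nonneg_left ?_ hC0.le
    push_cast
    rw [← Real.rpow_natCast, ← Real.rpow_mul (by positivity)]
    have hvW : (v : ℝ) ≤ W := (Nat.le_floor_iff hW).mp hv.2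
    calc (v : ℝ) ^ (((2 : ℕ) : ℝ) * (δ / 4)) = (v : ℝ) ^ (δ / 2) := by congr 1; push_cast; ring
      _ ≤ W ^ (δ / 2) := Real.rpow_le_rpow (by positivity) hvW (by positivity)
  have hharm : ∑ v ∈ Finset.Icc 1 ⌊W⌋₊, (v : ℝ)⁻¹ ≤ (1 + 2 / δ) * W ^ (δ / 2) := by
    have h2 := harmonic_floor_le_one_add_log W h1
    rw [harmonic_eq_sum_Icc] at h2
    push_cast at h2
    have h3 := Real.log_le_rpow_div hW (half_pos hδ)
    have h4 : 1 ≤ W ^ (δ / 2) := Real.one_le_rpow h1 (by positivity)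
    have h5 : W ^ (δ / 2) / (δ / 2) = 2 / δ * W ^ (δ / 2) := by field_simp
    rw [h5] at h3
    linarith
  have hW2 : W ^ δ = W ^ (δ / 2) * W ^ (δ / 2) := by
    rw [← Real.rpow_add (by linarith), add_halves]
  have hcount : (⌊W⌋₊ : ℝ) ≤ (1 + 2 / δ) * W ^ (δ / 2) * W := by
    have h4 : 1 ≤ W ^ (δ / 2) := Real.one_le_rpow h1 (by positivity)
    have h5 : 1 ≤ 1 + 2 / δ := by have : 0 < 2 / δ := by positivity
                                  linarith
    exact (Nat.floor_le hW).trans (le_mul_of_one_le_left hW (one_le_mul_of_one_le_of_one_le h5 h4))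
  calc _ ≤ ∑ v ∈ Finset.Icc 1 ⌊W⌋₊, C * W ^ (δ / 2) * (a * (v : ℝ)⁻¹ + 1) :=
        Finset.sum_le_sum hdiv
    _ = C * W ^ (δ / 2) * (a * ∑ v ∈ Finset.Icc 1 ⌊W⌋₊, (v : ℝ)⁻¹ + ⌊W⌋₊) := by
        rw [← Finset.mul_sum, Finset.sum_add_distrib, ← Finset.mul_sum]
        simp
    _ ≤ C * W ^ (δ / 2) * (a * ((1 + 2 / δ) * W ^ (δ / 2)) + (1 + 2 / δ) * W ^ (δ / 2) * W) := by
        gcongr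
    _ = _ := by rw [hW2]; ring

/-- The number of `d` in `[X, 2X)` for which `4 * N = u ^ 2 + d * v ^ 2` has a solution with `v`
nonzero and coprime to `N` is bounded by a divisor sum over `v ≤ W`, once `4 * N ≤ W ^ 2 * X`. -/
theorem Finset.card_le_sum_of_four_mul_eq_sq_add_mul_sq {N : ℤ} {X W : ℝ} {D : Finset ℕ}
    (hX : 0 < X) (hW : 0 ≤ W) (hN : 4 * (N : ℝ) ≤ W ^ 2 * X)
    (hD : ∀ d ∈ D, X ≤ (d : ℝ) ∧ (d : ℝ) < 2 * X)
    (hsol : ∀ d ∈ D, ∃ u v : ℤ, v ≠ 0 ∧ IsCoprime v N ∧ 4 * N = u ^ 2 + d * v ^ 2) :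
    (D.card : ℝ) ≤
      ∑ v ∈ Finset.Icc 1 ⌊W⌋₊, ((v ^ 2).divisors.card : ℝ) * (4 * √X / v + 1) := by
  classical
  set E : ℕ → Finset ℕ := fun v => D.filter fun d =>
    IsCoprime (v : ℤ) N ∧ ∃ u : ℤ, 4 * N = u ^ 2 + d * (v : ℤ) ^ 2 with hE
  have hsub : D ⊆ (Finset.Icc 1 ⌊W⌋₊).biUnion E := by
    intro d hd
    obtain ⟨u, v, hv, hcop, h⟩ := hsol d hd
    refine Finset.mem_biUnion.mpr ⟨v.natAbs, Finset.mem_Icc.mpr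
      ⟨Int.natAbs_pos.mpr hv, Nat.le_floor ?_⟩, Finset.mem_filter.mpr ⟨hd, ?_, u, ?_⟩⟩
    · refine le_of_sq_le_sq ?_ hW
      have h1 : 4 * (N : ℝ) = (u : ℝ) ^ 2 + d * (v : ℝ) ^ 2 := by exact_mod_cast h
      have h2 : ((v.natAbs : ℕ) : ℝ) ^ 2 = (v : ℝ) ^ 2 := by
        rw [Nat.cast_natAbs, Int.cast_abs, sq_abs]
      rw [h2]
      refine le_of_mul_le_mul_right ?_ hX
      have h3 := mul_le_mul_of_nonneg_right (hD d hd).1 (sq_nonneg (v : ℝ))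
      nlinarith [sq_nonneg (u : ℝ)]
    · rw [Int.natCast_natAbs]
      exact hcop.abs_left
    · rwa [Int.natCast_natAbs, sq_abs]
  calc (D.card : ℝ) ≤ ((∑ v ∈ Finset.Icc 1 ⌊W⌋₊, (E v).card : ℕ) : ℝ) := by
        exact_mod_cast (Finset.card_le_card hsub).trans Finset.card_biUnion_le
    _ ≤ _ := by
        push_cast
        refine Finset.sum_le_sum fun v hv => ?_
        rcases (E v).eq_empty_or_nonempty with h | ⟨d, hd⟩
        · rw [h, Finset.card_empty, Nat.cast_zero]; positivity
        · exact Finset.card_le_of_four_mul_eq_sq_add_mul_sq (Finset.mem_Icc.mp hv).1 hX.le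
            (Finset.mem_filter.mp hd).2.1 (fun d hd => hD d (Finset.mem_filter.mp hd).1)
            fun d hd => (Finset.mem_filter.mp hd).2.2

/-- Fix a prime `g ≥ 3`.  For every `ε > 0` there is `C = C(g, ε)` such that
for all `X ≥ 2` and all `Z` with `X^(1/(2g)) ≤ Z ≤ X`,
`∑_{X ≤ d < 2X, d squarefree} S_g(d;Z) ≤ C·X^ε·(Z²X^(1/2) + Z^(g+2)X^(-1/2))`. -/
theorem average_Sg_bound (g : ℕ) (hg : g.Prime) (hg3 : 3 ≤ g)
    (ε : ℝ) (hε : 0 < ε) :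
    ∃ C : ℝ, 0 < C ∧ ∀ X Z : ℝ, 2 ≤ X →
      X ^ ((1 : ℝ) / (2 * g)) ≤ Z → Z ≤ X →
      ∑ d ∈ (Finset.range (⌈2 * X⌉₊ + 1)).filter
          (fun d : ℕ => Squarefree d ∧ X ≤ (d : ℝ) ∧ (d : ℝ) < 2 * X),
        (Sg g d Z : ℝ)
      ≤ C * X ^ ε * (Z ^ 2 * X ^ ((1 : ℝ) / 2) + Z ^ (g + 2) * X ^ (-(1 : ℝ) / 2)) := by
  classical
  have hg0 : (0 : ℝ) < g := by exact_mod_cast hg.pos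
  have hδ : 0 < ε / g := by positivity
  obtain ⟨C, hC, hsum⟩ := exists_sum_card_divisors_sq_le hδ
  refine ⟨9 * (C * ((2 : ℝ) ^ (g + 1)) ^ (ε / g) * 2 ^ (g + 2)), by positivity,
    fun X Z hX hXZ hZX => ?_⟩
  have hX0 : 0 < X := by linarith
  have hX1 : 1 ≤ X := by linarith
  have hZ1 : 1 ≤ Z := (Real.one_le_rpow hX1 (by positivity)).trans hXZ
  have hZ0 : 0 < Z := by linarith
  have hsX : 1 ≤ √X := Real.one_le_sqrt.mpr hX1
  set D := (Finset.range (⌈2 * X⌉₊ + 1)).filter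
    (fun d : ℕ => Squarefree d ∧ X ≤ (d : ℝ) ∧ (d : ℝ) < 2 * X) with hDdef
  have hD : ∀ d ∈ D, X ≤ (d : ℝ) ∧ (d : ℝ) < 2 * X := fun d hd => (Finset.mem_filter.mp hd).2.2
  set P := Finset.range ⌈2 * Z⌉₊ with hP
  let r : ℕ → ℕ × ℕ → Prop := fun d pq => ∃ u v : ℤ, v ≠ 0 ∧
    IsCoprime v (((pq.1 : ℤ) * pq.2) ^ g) ∧ 4 * ((pq.1 : ℤ) * pq.2) ^ g = u ^ 2 + (d : ℤ) * v ^ 2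
  have hSg : ∀ d, Sg g d Z ≤ ((P ×ˢ P).bipartiteAbove r d).card := by
    intro d
    rw [Sg, ← Nat.card_eq_finsetCard]
    refine Nat.card_le_card_of_injective (fun x => ⟨x.1, ?_⟩) fun x y hxy =>
      Subtype.ext (Subtype.mk.inj hxy)
    obtain ⟨-, -, -, -, hp, -, hq, u, v, -, hv, hcop, h⟩ := x.2
    exact Finset.mem_filter.mpr ⟨Finset.mem_product.mpr
      ⟨Finset.mem_range.mpr (Nat.lt_ceil.mpr hp), Finset.mem_range.mpr (Nat.lt_ceil.mpr hq)⟩,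
      u, v, hv, (Int.isCoprime_iff_gcd_eq_one.mpr hcop).pow_right, h⟩
  set W : ℝ := 2 * (2 * Z) ^ g / √X with hW
  have hW0 : 0 ≤ W := by positivity
  set B : ℝ := C * W ^ (ε / g) * (4 * √X + W) with hB
  have hpair : ∀ pq ∈ P ×ˢ P, ((D.bipartiteBelow r pq).card : ℝ) ≤ B := by
    rintro ⟨p, q⟩ hpq
    obtain ⟨hp, hq⟩ := Finset.mem_product.mp hpq
    have hp' : (p : ℝ) ≤ 2 * Z := (Nat.lt_ceil.mp (Finset.mem_range.mp hp)).le
    have hq' : (q : ℝ) ≤ 2 * Z := (Nat.lt_ceil.mp (Finset.mem_range.mp hq)).le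
    refine (Finset.card_le_sum_of_four_mul_eq_sq_add_mul_sq (N := ((p : ℤ) * q) ^ g) hX0 hW0 ?_
      (fun d hd => hD d (Finset.mem_filter.mp hd).1)
      fun d hd => (Finset.mem_filter.mp hd).2).trans (hsum _ _ (by positivity) hW0)
    rw [hW, div_pow, Real.sq_sqrt hX0.le, div_mul_cancel₀ _ hX0.ne']
    push_cast
    calc 4 * ((p : ℝ) * q) ^ g ≤ 4 * ((2 * Z) * (2 * Z)) ^ g := by gcongr
      _ = _ := by rw [mul_pow]; ring
  have hcardP : (P.card : ℝ) ≤ 3 * Z := by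
    rw [hP, Finset.card_range]
    linarith [Nat.ceil_lt_add_one (show 0 ≤ 2 * Z by positivity)]
  have htotal : ∑ d ∈ D, (Sg g d Z : ℝ) ≤ 9 * Z ^ 2 * B := by
    calc ∑ d ∈ D, (Sg g d Z : ℝ) ≤ ∑ d ∈ D, (((P ×ˢ P).bipartiteAbove r d).card : ℝ) :=
          Finset.sum_le_sum fun d _ => by exact_mod_cast hSg d
      _ = ∑ pq ∈ P ×ˢ P, ((D.bipartiteBelow r pq).card : ℝ) := by
          exact_mod_cast Finset.sum_card_bipartiteAbove_eq_sum_card_bipartiteBelow r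
      _ ≤ (P ×ˢ P).card • B := Finset.sum_le_card_nsmul _ _ _ hpair
      _ = (P.card : ℝ) * P.card * B := by
          rw [nsmul_eq_mul, Finset.card_product, Nat.cast_mul]
      _ ≤ (3 * Z) * (3 * Z) * B := by gcongr
      _ = _ := by ring
  have hWle : W ≤ 2 ^ (g + 1) * X ^ g := by
    calc W ≤ 2 * (2 * Z) ^ g := div_le_self (by positivity) hsX
      _ ≤ 2 * (2 * X) ^ g := by gcongr
      _ = _ := by rw [mul_pow]; ring
  have hWpow : W ^ (ε / g) ≤ ((2 : ℝ) ^ (g + 1)) ^ (ε / g) * X ^ ε := by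
    refine (Real.rpow_le_rpow hW0 hWle hδ.le).trans (le_of_eq ?_)
    rw [Real.mul_rpow (by positivity) (by positivity), ← Real.rpow_natCast X g,
      ← Real.rpow_mul hX0.le, mul_div_cancel₀ _ hg0.ne']
  have hhalf : X ^ (-(1 : ℝ) / 2) = (√X)⁻¹ := by
    rw [Real.sqrt_eq_rpow, ← Real.rpow_neg hX0.le]; norm_num
  have hadd : 4 * √X + W ≤ 2 ^ (g + 2) * (√X + Z ^ g * (√X)⁻¹) := by
    have h1 : W = 2 ^ (g + 1) * (Z ^ g * (√X)⁻¹) := by rw [hW, mul_pow]; ring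
    have h2 : (1 : ℝ) ≤ 2 ^ g := one_le_pow₀ one_le_two
    have h3 : 0 ≤ Z ^ g * (√X)⁻¹ := by positivity
    rw [h1, pow_add, pow_add]
    nlinarith [mul_le_mul_of_nonneg_right h2 (Real.sqrt_nonneg X),
      mul_nonneg (zero_le_one.trans h2) h3]
  rw [← Real.sqrt_eq_rpow, hhalf]
  calc _ ≤ 9 * Z ^ 2 * B := htotal
    _ ≤ 9 * Z ^ 2 * (C * (((2 : ℝ) ^ (g + 1)) ^ (ε / g) * X ^ ε) *
          (2 ^ (g + 2) * (√X + Z ^ g * (√X)⁻¹))) := by rw [hB]; gcongr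
    _ = _ := by ring
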